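/- arXiv:2302.04433 — 3 statements merged into one kernel-verified Lean document; each statement's English description precedes it below -/
import Mathlib

section
/- Let ũ, u, b, c ∈ H satisfy the orthogonality condition ⟨3u − 4b + c, ũ − u⟩ = 0. Then ⟨3ũ − 4b + c, ũ⟩ = (3/2)(‖ũ‖² − ‖u‖² + ‖ũ − u‖²) + (1/2)(‖u‖² + ‖2u − b‖²) − (1/2)(‖b‖² + ‖2b − c‖²) + (1/2)‖u − 2b + c‖². (This is identity (3.17) in the stability proof of the second-order schemes, with ũ = ũ^{n+1}, u = u^{n+1}, b = u^n, c = u^{n-1}; the orthogonality hypothesis encodes that ũ^{n+1} − u^{n+1} is a discrete pressure gradient while 3u^{n+1} − 4u^n + u^{n-1} is discretely divergence free.) -/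
open RealInnerProductSpace

/-- Identity (3.17) in the stability proof of the second-order schemes. -/
theorem bdf2_projection_inner_identity
    {H : Type*} [NormedAddCommGroup H] [InnerProductSpace ℝ H]
    (utilde u b c : H)
    (horth : ⟪(3 : ℝ) • u - (4 : ℝ) • b + c, utilde - u⟫ = 0) :
    ⟪(3 : ℝ) • utilde - (4 : ℝ) • b + c, utilde⟫
      = (3 / 2) * (‖utilde‖ ^ 2 - ‖u‖ ^ 2 + ‖utilde - u‖ ^ 2)
        + (1 / 2) * (‖u‖ ^ 2 + ‖(2 : ℝ) • u - b‖ ^ 2)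
        - (1 / 2) * (‖b‖ ^ 2 + ‖(2 : ℝ) • b - c‖ ^ 2)
        + (1 / 2) * ‖u - (2 : ℝ) • b + c‖ ^ 2 := by
  simp only [← real_inner_self_eq_norm_sq, inner_add_left, inner_add_right, inner_sub_left,
    inner_sub_right, real_inner_smul_left, real_inner_smul_right] at horth ⊢
  linarith [real_inner_comm u utilde, real_inner_comm b u, real_inner_comm c u, real_inner_comm c b]
end

section
/- Let Δt > 0, s > 0, N ≥ 0, A ≥ 0, and S ∈ ℝ be real numbers, let u⁰, ũ, u¹, g⁰, g¹ ∈ H, let r⁰, r¹ ∈ ℝ, and set ξ := r¹/s. Assume: (i) the tested momentum equation ⟨ũ − u⁰, ũ⟩ + Δt·ξ·S + Δt·N + Δt·⟨g⁰, ũ⟩ = 0 holds (here N represents the nonnegative viscous dissipation ν‖∇ũ‖² and S the coupling term); (ii) the pressure-correction relations u¹ + Δt·g¹ = ũ + Δt·g⁰ and ⟨u¹, g¹⟩ = 0 hold; (iii) the auxiliary-variable update r¹ − r⁰ = −(Δt/(2s))·(ξ·A − S) holds (here A represents the nonnegative concentration dissipation). Then the discrete energy decays: ‖u¹‖² + Δt²‖g¹‖²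 + 2(r¹)² ≤ ‖u⁰‖² + Δt²‖g⁰‖² + 2(r⁰)². (This is the unconditional energy dissipation of the first-order scheme, part iii) of Theorem 3.1, formulated abstractly with the tested weak-form equations as hypotheses.) -/
open RealInnerProductSpace

/-- Unconditional energy dissipation of the first-order scheme
(part iii) of Theorem 3.1), formulated abstractly. -/
theorem first_order_energy_dissipation
    {H : Type*} [NormedAddCommGroup H] [InnerProductSpace ℝ H]
    (Δt s N A S : ℝ) (hΔt : 0 < Δt) (hs : 0 < s) (hN : 0 ≤ N) (hA : 0 ≤ A)
    (u0 utilde u1 g0 g1 : H) (r0 r1 : ℝ) (ξ : ℝ) (hξ : ξ = r1 / s)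
    (hmom : ⟪utilde - u0, utilde⟫ + Δt * ξ * S + Δt * N + Δt * ⟪g0, utilde⟫ = 0)
    (hpc : u1 + Δt • g1 = utilde + Δt • g0)
    (horth : ⟪u1, g1⟫ = 0)
    (hr : r1 - r0 = -(Δt / (2 * s)) * (ξ * A - S)) :
    ‖u1‖ ^ 2 + Δt ^ 2 * ‖g1‖ ^ 2 + 2 * r1 ^ 2
      ≤ ‖u0‖ ^ 2 + Δt ^ 2 * ‖g0‖ ^ 2 + 2 * r0 ^ 2 := by
  have hcorr : ‖u1‖ ^ 2 + Δt ^ 2 * ‖g1‖ ^ 2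
      = ‖utilde‖ ^ 2 + 2 * Δt * ⟪g0, utilde⟫ + Δt ^ 2 * ‖g0‖ ^ 2 := by
    have h : ‖u1 + Δt • g1‖ ^ 2 = ‖utilde + Δt • g0‖ ^ 2 := by rw [hpc]
    rw [norm_add_sq_real, norm_add_sq_real, inner_smul_right, inner_smul_right, horth,
      norm_smul, norm_smul, mul_pow, mul_pow, Real.norm_eq_abs, sq_abs,
      real_inner_comm] at h
    linarith
  have hincr : 2 * ⟪utilde - u0, utilde⟫
      = ‖utilde‖ ^ 2 - ‖u0‖ ^ 2 + ‖utilde - u0‖ ^ 2 := by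
    rw [norm_sub_sq_real, inner_sub_left, real_inner_self_eq_norm_sq, real_inner_comm]
    ring
  have haux : 2 * r1 ^ 2 - 2 * r0 ^ 2 + 2 * (r1 - r0) ^ 2
      = -(2 * Δt * ξ ^ 2 * A) + 2 * Δt * ξ * S := by
    have h : r1 * (r1 - r0) = -(Δt / 2) * ξ * (ξ * A - S) := by
      rw [hr, hξ]
      field_simp
    linear_combination 4 * h
  have hvisc : 0 ≤ Δt * N := by positivity
  have hconc : 0 ≤ Δt * ξ ^ 2 * A := by positivity
  linarith [sq_nonneg (r1 - r0), sq_nonneg ‖utilde - u0‖]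
end

section
/- Let Δt > 0, s > 0, N ≥ 0, A ≥ 0, and S ∈ ℝ be real numbers, let u⁰, u¹, ũ, u², ḡ¹, ḡ² ∈ H, let r⁰, r¹, r² ∈ ℝ, and set ξ := r²/s. Assume: (i) the tested momentum equation ⟨3ũ − 4u¹ + u⁰, ũ⟩ + 2Δt·ξ·S + 2Δt·N + 2Δt·⟨ḡ¹, ũ⟩ = 0 holds (here N represents the nonnegative viscous dissipation ν‖∇ũ‖² and S the coupling term); (ii) the pressure-correction relations √(3/2)·u² + √(2/3)·Δt·ḡ² = √(3/2)·ũ + √(2/3)·Δt·ḡ¹ and ⟨u², ḡ²⟩ = 0 hold; (iii) the orthogonality ⟨3u² − 4u¹ + u⁰, ũ − u²⟩ = 0 holds; (iv) the auxiliary-variable update (3r² − 4r¹ + r⁰)/(2Δt) = −(1/(2s))·(ξ·A − S) holds (here A represents the nonnegative concentration dissipation). Then the discrete energy decays: (1/2)‖u²‖² + (1/2)‖2u² − u¹‖² + (2/3)Δt²‖ḡ²‖² + (r²)² + (2r² − r¹)² ≤ (1/2)‖u¹‖² + (1/2)‖2u¹ − u⁰‖² + (2/3)Δt²‖ḡ¹‖²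 + (r¹)² + (2r¹ − r⁰)². (This is the unconditional energy dissipation of the second-order scheme Scheme2b, part iii) of Theorem 3.2, formulated abstractly with the tested weak-form equations as hypotheses.) -/
open RealInnerProductSpace

/-- The polarization identity behind the energy stability of the second-order backward
differentiation formula. -/
theorem two_mul_inner_bdf2 {H : Type*} [NormedAddCommGroup H] [InnerProductSpace ℝ H]
    (a b c : H) :
    2 * ⟪(3 : ℝ) • c - (4 : ℝ) • b + a, c⟫
      = ‖c‖ ^ 2 + ‖(2 : ℝ) • c - b‖ ^ 2 - ‖b‖ ^ 2 - ‖(2 : ℝ) • b - a‖ ^ 2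
        + ‖c - (2 : ℝ) • b + a‖ ^ 2 := by
  simp only [← real_inner_self_eq_norm_sq, inner_add_left, inner_sub_left, inner_add_right,
    inner_sub_right, real_inner_smul_left, real_inner_smul_right]
  rw [real_inner_comm a c, real_inner_comm b c, real_inner_comm a b]
  ring

theorem norm_sq_sqrt_smul_add {H : Type*} [NormedAddCommGroup H] [InnerProductSpace ℝ H]
    (t : ℝ) (x y : H) :
    ‖Real.sqrt (3 / 2) • x + (Real.sqrt (2 / 3) * t) • y‖ ^ 2
      = (3 / 2) * ‖x‖ ^ 2 + (2 / 3) * t ^ 2 * ‖y‖ ^ 2 + 2 * t * ⟪x, y⟫ := by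
  have h₁ : Real.sqrt (3 / 2) ^ 2 = 3 / 2 := Real.sq_sqrt (by norm_num)
  have h₂ : Real.sqrt (2 / 3) ^ 2 = 2 / 3 := Real.sq_sqrt (by norm_num)
  have h₁₂ : Real.sqrt (3 / 2) * Real.sqrt (2 / 3) = 1 := by
    rw [← Real.sqrt_mul (by norm_num)]
    norm_num
  rw [norm_add_sq_real, norm_smul, norm_smul, mul_pow, mul_pow, Real.norm_eq_abs,
    Real.norm_eq_abs, sq_abs, sq_abs, real_inner_smul_left, real_inner_smul_right]
  linear_combination ‖x‖ ^ 2 * h₁ + t ^ 2 * ‖y‖ ^ 2 * h₂ + 2 * t * ⟪x, y⟫ * h₁₂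

/-- Unconditional energy dissipation of the second-order scheme Scheme2b
(part iii) of Theorem 3.2), formulated abstractly. -/
theorem second_order_energy_dissipation
    {H : Type*} [NormedAddCommGroup H] [InnerProductSpace ℝ H]
    (Δt s N A S : ℝ) (hΔt : 0 < Δt) (hs : 0 < s) (hN : 0 ≤ N) (hA : 0 ≤ A)
    (u0 u1 utilde u2 g1 g2 : H) (r0 r1 r2 : ℝ) (ξ : ℝ) (hξ : ξ = r2 / s)
    (hmom : ⟪(3 : ℝ) • utilde - (4 : ℝ) • u1 + u0, utilde⟫
        + 2 * Δt * ξ * S + 2 * Δt * N + 2 * Δt * ⟪g1, utilde⟫ = 0)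
    (hpc : Real.sqrt (3 / 2) • u2 + (Real.sqrt (2 / 3) * Δt) • g2
        = Real.sqrt (3 / 2) • utilde + (Real.sqrt (2 / 3) * Δt) • g1)
    (horth1 : ⟪u2, g2⟫ = 0)
    (horth2 : ⟪(3 : ℝ) • u2 - (4 : ℝ) • u1 + u0, utilde - u2⟫ = 0)
    (hr : (3 * r2 - 4 * r1 + r0) / (2 * Δt) = -(1 / (2 * s)) * (ξ * A - S)) :
    (1 / 2) * ‖u2‖ ^ 2 + (1 / 2) * ‖(2 : ℝ) • u2 - u1‖ ^ 2
        + (2 / 3) * Δt ^ 2 * ‖g2‖ ^ 2 + r2 ^ 2 + (2 * r2 - r1) ^ 2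
      ≤ (1 / 2) * ‖u1‖ ^ 2 + (1 / 2) * ‖(2 : ℝ) • u1 - u0‖ ^ 2
        + (2 / 3) * Δt ^ 2 * ‖g1‖ ^ 2 + r1 ^ 2 + (2 * r1 - r0) ^ 2 := by
  have hpc_norm : (3 / 2) * ‖u2‖ ^ 2 + (2 / 3) * Δt ^ 2 * ‖g2‖ ^ 2
      = (3 / 2) * ‖utilde‖ ^ 2 + (2 / 3) * Δt ^ 2 * ‖g1‖ ^ 2 + 2 * Δt * ⟪g1, utilde⟫ := by
    have h := congrArg (fun x : H => ‖x‖ ^ 2) hpc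
    rw [norm_sq_sqrt_smul_add, norm_sq_sqrt_smul_add, horth1, real_inner_comm] at h
    linarith
  have hr' : 2 * r2 * (3 * r2 - 4 * r1 + r0) = 2 * Δt * ξ * S - 2 * Δt * ξ ^ 2 * A := by
    subst hξ
    field_simp at hr ⊢
    linear_combination r2 * hr
  have hbdf : 2 * ⟪(3 : ℝ) • u2 - (4 : ℝ) • u1 + u0, u2⟫
      = ‖u2‖ ^ 2 + ‖(2 : ℝ) • u2 - u1‖ ^ 2 - ‖u1‖ ^ 2 - ‖(2 : ℝ) • u1 - u0‖ ^ 2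
        + ‖u2 - (2 : ℝ) • u1 + u0‖ ^ 2 := two_mul_inner_bdf2 u0 u1 u2
  have hsplit : ⟪(3 : ℝ) • utilde - (4 : ℝ) • u1 + u0, utilde⟫
      = ⟪(3 : ℝ) • u2 - (4 : ℝ) • u1 + u0, u2⟫
        + ⟪(3 : ℝ) • u2 - (4 : ℝ) • u1 + u0, utilde - u2⟫
        + (3 / 2) * (‖utilde‖ ^ 2 - ‖u2‖ ^ 2 + ‖utilde - u2‖ ^ 2) := by
    simp only [← real_inner_self_eq_norm_sq, inner_add_left, inner_sub_left, inner_sub_right,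
      real_inner_smul_left]
    rw [real_inner_comm u2 utilde]
    ring
  have hξA : 0 ≤ Δt * ξ ^ 2 * A := by positivity
  have hΔtN : 0 ≤ Δt * N := by positivity
  linarith [sq_nonneg ‖utilde - u2‖, sq_nonneg ‖u2 - (2 : ℝ) • u1 + u0‖,
    sq_nonneg (r2 - 2 * r1 + r0)]
end
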